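/- Let γ > 0, σ > 0, μ ∈ ℝ, l < u. On a probability space, let X and W be independent real random variables with X Gaussian of mean μ and variance γ², and W Gaussian of mean 0 and variance σ². Set R := X + W, s := √(γ² + σ²), a := (l−μ)/s, b := (u−μ)/s. Then P(l < R ≤ u) = Φ(b) − Φ(a) > 0 and E[ X · 1{l < R ≤ u} ] = P(l < R ≤ u) · ( μ + (γ²/s) · (φ(a) − φ(b)) / (Φ(b) − Φ(a)) ); equivalently, the conditional expectation of X given the event {l < R ≤ u} equals μ + (γ²/s)·(φ(a) − φ(b))/(Φ(b) − Φ(a)). (Probabilistic form of Theorem 3.) -/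

import Mathlib

open MeasureTheory ProbabilityTheory Real

/-- Standard normal density. -/
noncomputable def stdGaussPDF (z : ℝ) : ℝ :=
  (Real.sqrt (2 * Real.pi))⁻¹ * Real.exp (-z ^ 2 / 2)

/-- Standard normal CDF. -/
noncomputable def stdGaussCDF (z : ℝ) : ℝ :=
  ∫ t in Set.Iic z, stdGaussPDF t

open scoped NNReal

lemma stdGaussPDF_eq_gaussianPDFReal : stdGaussPDF = gaussianPDFReal 0 1 := by
  ext z
  simp [stdGaussPDF, gaussianPDFReal]

lemma integrable_stdGaussPDF : Integrable stdGaussPDF :=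
  stdGaussPDF_eq_gaussianPDFReal ▸ integrable_gaussianPDFReal 0 1

lemma stdGaussPDF_pos (z : ℝ) : 0 < stdGaussPDF z :=
  stdGaussPDF_eq_gaussianPDFReal ▸ gaussianPDFReal_pos 0 1 z one_ne_zero

lemma continuous_stdGaussPDF : Continuous stdGaussPDF := by
  unfold stdGaussPDF
  fun_prop

lemma hasDerivAt_neg_stdGaussPDF (z : ℝ) :
    HasDerivAt (fun x ↦ -stdGaussPDF x) (stdGaussPDF z * z) z := by
  have h : HasDerivAt (fun x : ℝ ↦ -x ^ 2 / 2) (-z) z := by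
    refine (((hasDerivAt_id z).pow 2).neg.div_const 2).congr_deriv ?_
    simp
    ring
  refine ((h.exp.const_mul (Real.sqrt (2 * Real.pi))⁻¹).neg).congr_deriv ?_
  simp only [stdGaussPDF]
  ring

lemma stdGaussCDF_sub (a b : ℝ) :
    stdGaussCDF b - stdGaussCDF a = ∫ t in a..b, stdGaussPDF t :=
  intervalIntegral.integral_Iic_sub_Iic integrable_stdGaussPDF.integrableOn
    integrable_stdGaussPDF.integrableOn

lemma stdGaussCDF_strictMono : StrictMono stdGaussCDF := fun a b hab ↦ by
  rw [← sub_pos, stdGaussCDF_sub]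
  exact intervalIntegral.intervalIntegral_pos_of_pos
    (continuous_stdGaussPDF.intervalIntegrable a b) stdGaussPDF_pos hab

lemma gaussianReal_real_Ioc {a b : ℝ} (hab : a ≤ b) :
    (gaussianReal 0 1).real (Set.Ioc a b) = stdGaussCDF b - stdGaussCDF a := by
  rw [measureReal_def, gaussianReal_apply_eq_integral 0 one_ne_zero,
    ← stdGaussPDF_eq_gaussianPDFReal, ENNReal.toReal_ofReal, stdGaussCDF_sub,
    intervalIntegral.integral_of_le hab]
  exact integral_nonneg fun x ↦ (stdGaussPDF_pos x).le

lemma setIntegral_Ioc_id_gaussianReal {a b : ℝ} (hab : a ≤ b) :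
    ∫ x in Set.Ioc a b, x ∂gaussianReal 0 1 = stdGaussPDF a - stdGaussPDF b := by
  rw [← integral_indicator measurableSet_Ioc, integral_gaussianReal_eq_integral_smul one_ne_zero,
    ← stdGaussPDF_eq_gaussianPDFReal]
  simp_rw [smul_eq_mul, ← Set.indicator_mul_right (Set.Ioc a b) stdGaussPDF (g := fun x ↦ x)]
  rw [integral_indicator measurableSet_Ioc, ← intervalIntegral.integral_of_le hab,
    intervalIntegral.integral_eq_sub_of_hasDerivAt (fun x _ ↦ hasDerivAt_neg_stdGaussPDF x)
      ((continuous_stdGaussPDF.mul continuous_id).intervalIntegrable a b)]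
  ring

/-- For independent Gaussian `X` and `W`, the residual of the linear regression of `X` on `X + W`
is independent of `X + W`. -/
lemma indepFun_sub_const_mul_add_of_gaussianReal {Ω : Type*} [MeasurableSpace Ω] {P : Measure Ω}
    {m₁ m₂ : ℝ} {v₁ v₂ : ℝ≥0} {X W : Ω → ℝ} (hXW : IndepFun X W P)
    (hX : HasLaw X (gaussianReal m₁ v₁) P) (hW : HasLaw W (gaussianReal m₂ v₂) P)
    {c : ℝ} (hc : c * (v₁ + v₂) = v₁) :
    IndepFun (fun ω ↦ X ω - c * (X ω + W ω)) (fun ω ↦ X ω + W ω) P := by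
  have hXg := hX.hasGaussianLaw
  have hWg := hW.hasGaussianLaw
  have := hXg.isProbabilityMeasure
  have hpair := hXW.hasGaussianLaw hXg hWg
  have hXL := hXg.memLp_two
  have hWL := hWg.memLp_two
  have hRL : MemLp (X + W) 2 P := hXL.add hWL
  let S : ℝ × ℝ →L[ℝ] ℝ := .fst ℝ ℝ ℝ + .snd ℝ ℝ ℝ
  have hjoint : HasGaussianLaw (fun ω ↦ (X ω - c * (X ω + W ω), X ω + W ω)) P :=
    hpair.map_fun ((ContinuousLinearMap.fst ℝ ℝ ℝ - c • S).prod S)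
  refine hjoint.indepFun_of_covariance_eq_zero ?_
  have hvX : cov[X, X; P] = v₁ := by
    rw [covariance_self hX.aemeasurable, hX.variance_eq, variance_id_gaussianReal]
  have hvW : cov[W, W; P] = v₂ := by
    rw [covariance_self hW.aemeasurable, hW.variance_eq, variance_id_gaussianReal]
  have h0 : cov[X, W; P] = 0 := hXW.covariance_eq_zero hXL hWL
  calc cov[X - c • (X + W), X + W; P]
      = (cov[X, X; P] + cov[X, W; P]) - c * ((cov[X, X; P] + cov[X, W; P])
          + (cov[W, X; P] + cov[W, W; P])) := by
        rw [covariance_sub_left hXL (hRL.const_smul c) hRL, covariance_smul_left,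
          covariance_add_left hXL hWL hRL, covariance_add_right hXL hXL hWL,
          covariance_add_right hWL hXL hWL]
    _ = 0 := by
        rw [covariance_comm W X, hvX, hvW, h0]
        linear_combination -hc

/-- Probabilistic form of Theorem 3: conditional mean of a Gaussian `X` given that the
noisy version `R = X + W` falls in the quantization interval `(l, u]`. -/
theorem stmt_13 {Ω : Type*} [MeasurableSpace Ω] (P : Measure Ω) [IsProbabilityMeasure P]
    (γ σ μ l u : ℝ) (hγ : 0 < γ) (hσ : 0 < σ) (hlu : l < u)
    (X W : Ω → ℝ)
    (hXmeas : Measurable X) (hWmeas : Measurable W)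
    (hIndep : IndepFun X W P)
    (hX : Measure.map X P = gaussianReal μ (Real.toNNReal (γ ^ 2)))
    (hW : Measure.map W P = gaussianReal 0 (Real.toNNReal (σ ^ 2)))
    (s a b : ℝ) (hs : s = Real.sqrt (γ ^ 2 + σ ^ 2))
    (ha : a = (l - μ) / s) (hb : b = (u - μ) / s) :
    0 < stdGaussCDF b - stdGaussCDF a ∧
    (P {ω | l < X ω + W ω ∧ X ω + W ω ≤ u}).toReal = stdGaussCDF b - stdGaussCDF a ∧
    (∫ ω in {ω | l < X ω + W ω ∧ X ω + W ω ≤ u}, X ω ∂P) =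
      (stdGaussCDF b - stdGaussCDF a) *
        (μ + γ ^ 2 / s * ((stdGaussPDF a - stdGaussPDF b) / (stdGaussCDF b - stdGaussCDF a))) := by
  have hs0 : 0 < s := hs ▸ Real.sqrt_pos.2 (by positivity)
  have hs2 : s ^ 2 = γ ^ 2 + σ ^ 2 := hs ▸ Real.sq_sqrt (by positivity)
  have hab : a < b := by
    rw [ha, hb]
    gcongr
  have hpos : 0 < stdGaussCDF b - stdGaussCDF a := sub_pos.2 (stdGaussCDF_strictMono hab)
  have hXlaw : HasLaw X (gaussianReal μ (γ ^ 2).toNNReal) P := ⟨hXmeas.aemeasurable, hX⟩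
  have hWlaw : HasLaw W (gaussianReal 0 (σ ^ 2).toNNReal) P := ⟨hWmeas.aemeasurable, hW⟩
  set V : Ω → ℝ := fun ω ↦ (X ω + W ω - μ) / s with hV
  have hRmeas : Measurable fun ω ↦ X ω + W ω := hXmeas.add hWmeas
  have hVmeas : Measurable V := (hRmeas.sub_const μ).div_const s
  have hVlaw : P.map V = gaussianReal 0 1 := by
    have hR : HasLaw (X + W)
        (gaussianReal (μ + 0) ((γ ^ 2).toNNReal + (σ ^ 2).toNNReal)) P :=
      ⟨hRmeas.aemeasurable, gaussianReal_add_gaussianReal_of_indepFun hIndep hX hW⟩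
    refine ((gaussianReal_div_const (gaussianReal_sub_const hR μ) s).map_eq).trans ?_
    congr 1
    · simp
    · ext
      push_cast
      rw [Real.coe_toNNReal _ (sq_nonneg γ), Real.coe_toNNReal _ (sq_nonneg σ), ← hs2]
      exact div_self (by positivity)
  have hE : {ω | l < X ω + W ω ∧ X ω + W ω ≤ u} = V ⁻¹' Set.Ioc a b := by
    ext ω
    simp only [Set.mem_ofPred_eq, Set.mem_preimage, Set.mem_Ioc, hV, ha, hb,
      div_lt_div_iff_of_pos_right hs0, div_le_div_iff_of_pos_right hs0, sub_lt_sub_iff_right,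
      sub_le_sub_iff_right]
  have hProb : P.real (V ⁻¹' Set.Ioc a b) = stdGaussCDF b - stdGaussCDF a := by
    rw [← map_measureReal_apply hVmeas measurableSet_Ioc, hVlaw, gaussianReal_real_Ioc hab.le]
  have hVint : ∫ ω in V ⁻¹' Set.Ioc a b, V ω ∂P = stdGaussPDF a - stdGaussPDF b := by
    rw [← setIntegral_Ioc_id_gaussianReal hab.le, ← hVlaw,
      setIntegral_map measurableSet_Ioc (by fun_prop) hVmeas.aemeasurable]
  have hXi : Integrable X P := hXlaw.hasGaussianLaw.integrable
  have hWi : Integrable W P := hWlaw.hasGaussianLaw.integrable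
  have hVi : Integrable V P := ((hXi.add hWi).sub (integrable_const μ)).div_const s
  have hXmean : ∫ ω, X ω ∂P = μ := by rw [hXlaw.integral_eq, integral_id_gaussianReal]
  have hWmean : ∫ ω, W ω ∂P = 0 := by rw [hWlaw.integral_eq, integral_id_gaussianReal]
  set c : ℝ := γ ^ 2 / s ^ 2 with hc
  set Z : Ω → ℝ := fun ω ↦ X ω - c * (X ω + W ω) with hZ
  have hZmeas : Measurable Z := hXmeas.sub (hRmeas.const_mul c)
  have hZi : Integrable Z P := hXi.sub ((hXi.add hWi).const_mul c)
  have hZV : IndepFun V Z P := by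
    have := indepFun_sub_const_mul_add_of_gaussianReal hIndep hXlaw hWlaw (c := c) (by
      rw [Real.coe_toNNReal _ (sq_nonneg γ), Real.coe_toNNReal _ (sq_nonneg σ), ← hs2, hc]
      field_simp)
    exact (this.comp measurable_id ((measurable_id.sub_const μ).div_const s)).symm
  have hZmean : ∫ ω, Z ω ∂P = μ - c * μ := by
    simp only [hZ]
    rw [integral_sub hXi ((hXi.fun_add hWi).const_mul c), integral_const_mul,
      integral_add hXi hWi, hXmean, hWmean, add_zero]
  have hZint : ∫ ω in V ⁻¹' Set.Ioc a b, Z ω ∂P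
      = (stdGaussCDF b - stdGaussCDF a) * (μ - c * μ) := by
    rw [← hProb, ← hZmean]
    exact Indep.setIntegral_eq_mul (f := id) hVmeas.comap_le hZV hZmeas.aemeasurable
      ⟨_, measurableSet_Ioc, rfl⟩ aestronglyMeasurable_id
  have hdecomp : ∀ ω, X ω = Z ω + (c * μ + γ ^ 2 / s * V ω) := fun ω ↦ by
    simp only [hZ, hV, hc]
    field_simp
    ring
  refine ⟨hpos, hE ▸ hProb, ?_⟩
  rw [hE, integral_congr_ae (ae_of_all _ hdecomp), integral_add hZi.integrableOn
    ((integrable_const _).fun_add (hVi.const_mul _)).integrableOn, integral_add (integrable_const _)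
    (hVi.const_mul _).integrableOn, setIntegral_const, integral_const_mul, hZint, hVint, hProb,
    smul_eq_mul]
  field_simp
  ring
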